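/- arXiv:1808.09746 — 2 statements merged into one kernel-verified Lean document; each statement's English description precedes it below -/
import Mathlib

section
/- Let χ : [0,∞) → [0,1] be a smooth function with χ(τ) = 1 for τ ∈ [0,1/2] and χ(τ) = 0 for τ ≥ 1, and for m ≥ m₁, κ ∈ [−A,A], K ∈ [−B,B] define the quasimode v_m(τ) := χ(τ/√m)(u₀(τ) + m⁻¹u₁(τ) + m⁻²u₂(τ)) with u₀(τ) = e^{−τ}, u₁(τ) = −(κ/2)τe^{−τ}, u₂(τ) = (κ²/8 − K/2)τe^{−τ} + (3κ²/8 − K/2)τ²e^{−τ}. Then v_m ∈ V̂_{m,κ,K}, its derivative at the origin satisfies −v_m′(0) = 1 + κ/(2m) + m⁻²(K/2 − κ²/8), and there is a constant C > 0 (depending only on A, B and χ) such that ‖L̂_{m,κ,K} v_m‖_{L²((0,√m), a_{m,κ,K} dτ)} ≤ C m⁻³ for all m ≥ m₁, |κ| ≤ A, |K| ≤ B. -/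
open Set MeasureTheory

/-- The weight function `a_{m,κ,K}(τ) = 1 + τκ/m + τ²K/m²`. -/
noncomputable def wt (m κ K τ : ℝ) : ℝ := 1 + τ * κ / m + τ ^ 2 * K / m ^ 2

/-- Its derivative `a'_{m,κ,K}(τ) = κ/m + 2Kτ/m²`. -/
noncomputable def wt' (m κ K τ : ℝ) : ℝ := κ / m + 2 * K * τ / m ^ 2

/-- `u ∈ H¹((0,R); ℂ)` with distributional derivative `g`, expressed through the
continuous representative: `g ∈ L²(0,R)` and `u(x) = u(0) + ∫₀ˣ g` on `[0,R]`. -/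
def IsH1On (R : ℝ) (u g : ℝ → ℂ) : Prop :=
  MemLp g 2 (volume.restrict (Ioc (0 : ℝ) R)) ∧
  ∀ x ∈ Icc (0 : ℝ) R, u x = u 0 + ∫ t in Ioc (0 : ℝ) x, g t

/-- Membership in the admissible set `V̂_{m,κ,K}`. -/
def Adm (m : ℝ) (u g : ℝ → ℂ) : Prop :=
  IsH1On (Real.sqrt m) u g ∧ u 0 = 1 ∧ u (Real.sqrt m) = 0

/-- The operator `L̂_{m,κ,K} u = -u'' - (a'/a) u' + u` for a smooth function. -/
noncomputable def LhatD (m κ K : ℝ) (v : ℝ → ℂ) (τ : ℝ) : ℂ :=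
  -(deriv (deriv v) τ) - ((wt' m κ K τ / wt m κ K τ : ℝ) : ℂ) * deriv v τ + v τ

/-- The quasimode `v_m(τ) = χ(τ/√m)(u₀(τ) + m⁻¹u₁(τ) + m⁻²u₂(τ))`. -/
noncomputable def quasimode (χ : ℝ → ℝ) (m κ K : ℝ) (τ : ℝ) : ℂ :=
  ((χ (τ / Real.sqrt m) *
      (Real.exp (-τ)
        + (-(κ / 2) * τ * Real.exp (-τ)) / m
        + ((κ ^ 2 / 8 - K / 2) * τ * Real.exp (-τ)
            + (3 * κ ^ 2 / 8 - K / 2) * τ ^ 2 * Real.exp (-τ)) / m ^ 2) : ℝ) : ℂ)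

/-- The coefficient of `τ` in the polynomial factor of the quasimode, with `s = m⁻¹`. -/
noncomputable def linCoeff (s κ K : ℝ) : ℝ := -(κ / 2) * s + (κ ^ 2 / 8 - K / 2) * s ^ 2

/-- The coefficient of `τ²` in the polynomial factor of the quasimode, with `s = m⁻¹`. -/
noncomputable def quadCoeff (s κ K : ℝ) : ℝ := (3 * κ ^ 2 / 8 - K / 2) * s ^ 2

/-- The function `τ ↦ χ(rτ) (1 + ατ + βτ²) e^{-τ}`. -/
noncomputable def cutoffProfile (χ : ℝ → ℝ) (r α β t : ℝ) : ℝ :=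
  χ (t * r) * (1 + α * t + β * t ^ 2) * Real.exp (-t)

/-- The first derivative of `cutoffProfile χ r α β`. -/
noncomputable def cutoffProfileDeriv (χ : ℝ → ℝ) (r α β t : ℝ) : ℝ :=
  (r * deriv χ (t * r) * (1 + α * t + β * t ^ 2)
    + χ (t * r) * (α + 2 * β * t - (1 + α * t + β * t ^ 2))) * Real.exp (-t)

/-- The second derivative of `cutoffProfile χ r α β`. -/
noncomputable def cutoffProfileDeriv₂ (χ : ℝ → ℝ) (r α β t : ℝ) : ℝ :=
  (r ^ 2 * deriv (deriv χ) (t * r) * (1 + α * t + β * t ^ 2)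
    + 2 * r * deriv χ (t * r) * (α + 2 * β * t - (1 + α * t + β * t ^ 2))
    + χ (t * r) * (2 * β - 2 * (α + 2 * β * t) + (1 + α * t + β * t ^ 2))) * Real.exp (-t)

lemma quasimode_eq_cutoffProfile (χ : ℝ → ℝ) (m κ K : ℝ) :
    quasimode χ m κ K = fun τ =>
      ((cutoffProfile χ (Real.sqrt m)⁻¹ (linCoeff m⁻¹ κ K) (quadCoeff m⁻¹ κ K) τ : ℝ) : ℂ) := by
  funext τ
  simp only [quasimode, cutoffProfile, linCoeff, quadCoeff, div_eq_mul_inv _ (Real.sqrt m)]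
  congr 1
  simp only [div_eq_mul_inv, inv_pow]
  ring

lemma hasDerivAt_exp_neg (t : ℝ) :
    HasDerivAt (fun x => Real.exp (-x)) (-Real.exp (-t)) t := by
  simpa using (hasDerivAt_neg t).exp

lemma hasDerivAt_comp_mul {f : ℝ → ℝ} (hf : Differentiable ℝ f) (r t : ℝ) :
    HasDerivAt (fun x => f (x * r)) (r * deriv f (t * r)) t := by
  have h := (hf (t * r)).hasDerivAt.comp t (hasDerivAt_mul_const r)
  rwa [mul_comm] at h

lemma hasDerivAt_quadratic (α β t : ℝ) :
    HasDerivAt (fun x => 1 + α * x + β * x ^ 2) (α + 2 * β * t) t := by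
  have h := (((hasDerivAt_id t).const_mul α).const_add 1).add
    (((hasDerivAt_id t).pow 2).const_mul β)
  refine (h.congr_deriv ?_)
  simp
  ring

lemma hasDerivAt_affine (α β t : ℝ) :
    HasDerivAt (fun x => α + 2 * β * x) (2 * β) t := by
  have h := ((hasDerivAt_id t).const_mul (2 * β)).const_add α
  exact h.congr_deriv (mul_one _)

lemma hasDerivAt_cutoffProfile {χ : ℝ → ℝ} (hχ : Differentiable ℝ χ) (r α β t : ℝ) :
    HasDerivAt (cutoffProfile χ r α β) (cutoffProfileDeriv χ r α β t) t := by
  refine (((hasDerivAt_comp_mul hχ r t).mul (hasDerivAt_quadratic α β t)).mul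
    (hasDerivAt_exp_neg t)).congr_deriv ?_
  simp only [cutoffProfileDeriv, Pi.mul_apply]
  ring

lemma hasDerivAt_cutoffProfileDeriv {χ : ℝ → ℝ} (hχ : Differentiable ℝ χ)
    (hχ' : Differentiable ℝ (deriv χ)) (r α β t : ℝ) :
    HasDerivAt (cutoffProfileDeriv χ r α β) (cutoffProfileDeriv₂ χ r α β t) t := by
  have hP := hasDerivAt_quadratic α β t
  refine (((((hasDerivAt_comp_mul hχ' r t).const_mul r).mul hP).add
    ((hasDerivAt_comp_mul hχ r t).mul ((hasDerivAt_affine α β t).sub hP))).mul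
    (hasDerivAt_exp_neg t)).congr_deriv ?_
  simp only [cutoffProfileDeriv₂, Pi.mul_apply, Pi.add_apply, Pi.sub_apply]
  ring

lemma deriv_quasimode {χ : ℝ → ℝ} (hχ : Differentiable ℝ χ) (m κ K : ℝ) :
    deriv (quasimode χ m κ K) = fun τ =>
      ((cutoffProfileDeriv χ (Real.sqrt m)⁻¹ (linCoeff m⁻¹ κ K) (quadCoeff m⁻¹ κ K) τ : ℝ) : ℂ) := by
  rw [quasimode_eq_cutoffProfile]
  funext τ
  exact (hasDerivAt_cutoffProfile hχ _ _ _ τ).ofReal_comp.deriv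

lemma deriv_deriv_quasimode {χ : ℝ → ℝ} (hχ : Differentiable ℝ χ)
    (hχ' : Differentiable ℝ (deriv χ)) (m κ K : ℝ) :
    deriv (deriv (quasimode χ m κ K)) = fun τ =>
      ((cutoffProfileDeriv₂ χ (Real.sqrt m)⁻¹ (linCoeff m⁻¹ κ K) (quadCoeff m⁻¹ κ K) τ : ℝ) : ℂ) := by
  rw [deriv_quasimode hχ]
  funext τ
  exact (hasDerivAt_cutoffProfileDeriv hχ hχ' _ _ _ τ).ofReal_comp.deriv

lemma LhatD_quasimode {χ : ℝ → ℝ} (hχ : Differentiable ℝ χ)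
    (hχ' : Differentiable ℝ (deriv χ)) (m κ K τ : ℝ) :
    LhatD m κ K (quasimode χ m κ K) τ =
      ((-cutoffProfileDeriv₂ χ (Real.sqrt m)⁻¹ (linCoeff m⁻¹ κ K) (quadCoeff m⁻¹ κ K) τ
        - wt' m κ K τ / wt m κ K τ *
          cutoffProfileDeriv χ (Real.sqrt m)⁻¹ (linCoeff m⁻¹ κ K) (quadCoeff m⁻¹ κ K) τ
        + cutoffProfile χ (Real.sqrt m)⁻¹ (linCoeff m⁻¹ κ K) (quadCoeff m⁻¹ κ K) τ : ℝ) : ℂ) := by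
  rw [LhatD, deriv_deriv_quasimode hχ hχ', deriv_quasimode hχ, quasimode_eq_cutoffProfile]
  push_cast
  ring

lemma adm_quasimode {χ : ℝ → ℝ} (hχ : ContDiff ℝ 1 χ) (hχ_zero : χ 0 = 1) (hχ_one : χ 1 = 0)
    {m : ℝ} (hm : 0 < m) (κ K : ℝ) :
    Adm m (quasimode χ m κ K) (deriv (quasimode χ m κ K)) := by
  have hd : Differentiable ℝ χ := hχ.differentiable one_ne_zero
  have hd' : Continuous (deriv χ) := hχ.continuous_deriv le_rfl
  have hc : Continuous (deriv (quasimode χ m κ K)) := by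
    have := hd.continuous
    rw [deriv_quasimode hd]
    unfold cutoffProfileDeriv
    fun_prop
  have hdiff : Differentiable ℝ (quasimode χ m κ K) := by
    rw [quasimode_eq_cutoffProfile]
    exact fun τ => (hasDerivAt_cutoffProfile hd _ _ _ τ).ofReal_comp.differentiableAt
  refine ⟨⟨?_, fun x hx => ?_⟩, ?_, ?_⟩
  · obtain ⟨C, hC⟩ := (isCompact_Icc (a := (0 : ℝ)) (b := Real.sqrt m)).exists_bound_of_continuousOn
      hc.continuousOn
    refine MemLp.of_bound hc.aestronglyMeasurable C ?_
    filter_upwards [ae_restrict_mem measurableSet_Ioc] with x hx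
    exact hC x (Ioc_subset_Icc_self hx)
  · rw [← intervalIntegral.integral_of_le hx.1,
      intervalIntegral.integral_deriv_eq_sub (fun y _ => hdiff y) (hc.intervalIntegrable _ _)]
    ring
  · simp [quasimode, hχ_zero]
  · have : Real.sqrt m ≠ 0 := (Real.sqrt_pos.2 hm).ne'
    simp [quasimode, this, hχ_one]

lemma abs_cubic_le (a b c d : ℝ) {t : ℝ} (ht : 0 ≤ t) :
    |a + b * t + c * t ^ 2 + d * t ^ 3| ≤ |a| + |b| * t + |c| * t ^ 2 + |d| * t ^ 3 := by
  calc _ ≤ |a| + |b * t| + |c * t ^ 2| + |d * t ^ 3| :=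
        (abs_add_le _ _).trans (add_le_add_left ((abs_add_le _ _).trans
          (add_le_add_left (abs_add_le _ _) _)) _)
    _ = _ := by simp only [abs_mul, abs_pow, abs_of_nonneg ht]

lemma abs_quadratic_le (α β : ℝ) {t : ℝ} (ht : 0 ≤ t) :
    |1 + α * t + β * t ^ 2| ≤ (1 + |α| + |β|) * (1 + t) ^ 2 := by
  have h₁ := mul_nonneg (abs_nonneg α) ht
  have h₂ := mul_nonneg (abs_nonneg β) ht
  have h₃ := mul_nonneg (abs_nonneg α) (sq_nonneg t)
  have h := abs_cubic_le 1 α β 0 ht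
  simp only [zero_mul, add_zero, abs_zero, abs_one] at h
  nlinarith [abs_nonneg α, abs_nonneg β, sq_nonneg t]

lemma abs_affine_le (α β : ℝ) {t : ℝ} (ht : 0 ≤ t) :
    |α + 2 * β * t| ≤ 2 * (1 + |α| + |β|) * (1 + t) ^ 2 := by
  have h₁ := mul_nonneg (abs_nonneg α) ht
  have h₂ := mul_nonneg (abs_nonneg β) ht
  have h₃ := mul_nonneg (abs_nonneg α) (sq_nonneg t)
  have h₄ := mul_nonneg (abs_nonneg β) (sq_nonneg t)
  have h := abs_cubic_le α (2 * β) 0 0 ht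
  simp only [zero_mul, add_zero, abs_zero, abs_mul, abs_two] at h
  nlinarith [abs_nonneg α, abs_nonneg β, sq_nonneg t]

/-- The terms of order `m⁻¹` and `m⁻²` cancel when `a L̂` is applied to the quasimode expansion
without cutoff. -/
lemma abs_expansion_residual_le {A B : ℝ} :
    ∃ C : ℝ, 0 < C ∧ ∀ s κ K : ℝ, s ∈ Icc (0 : ℝ) 1 → |κ| ≤ A → |K| ≤ B →
      1 + |linCoeff s κ K| + |quadCoeff s κ K| ≤ C ∧ ∀ t : ℝ, 0 ≤ t →
      |(1 + s * κ * t + s ^ 2 * K * t ^ 2) *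
          (-(2 * quadCoeff s κ K) + 2 * (linCoeff s κ K + 2 * quadCoeff s κ K * t))
        - (s * κ + 2 * s ^ 2 * K * t) * (linCoeff s κ K + 2 * quadCoeff s κ K * t
          - (1 + linCoeff s κ K * t + quadCoeff s κ K * t ^ 2))| ≤ C * (1 + t) ^ 3 * s ^ 3 := by
  let a₂ : ℝ → ℝ → ℝ := fun κ K => κ ^ 2 / 8 - K / 2
  let b₂ : ℝ → ℝ → ℝ := fun κ K => 3 * κ ^ 2 / 8 - K / 2
  let c₀ : ℝ → ℝ → ℝ → ℝ := fun s κ K => -(κ * a₂ κ K)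
  let c₁ : ℝ → ℝ → ℝ → ℝ := fun s κ K => κ * (2 * a₂ κ K - 2 * b₂ κ K)
    - κ * (2 * b₂ κ K - a₂ κ K) + K * κ - 2 * s * K * a₂ κ K
  let c₂ : ℝ → ℝ → ℝ → ℝ := fun s κ K => 5 * κ * b₂ κ K - 2 * K * κ
    + s * K * (2 * a₂ κ K - 2 * b₂ κ K) - 2 * s * K * (2 * b₂ κ K - a₂ κ K)
  let c₃ : ℝ → ℝ → ℝ → ℝ := fun s κ K => 6 * s * K * b₂ κ K
  let F : ℝ × ℝ × ℝ → ℝ := fun p => (1 + |linCoeff p.1 p.2.1 p.2.2| + |quadCoeff p.1 p.2.1 p.2.2|)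
    + (|c₀ p.1 p.2.1 p.2.2| + |c₁ p.1 p.2.1 p.2.2| + |c₂ p.1 p.2.1 p.2.2| + |c₃ p.1 p.2.1 p.2.2|)
  have hF : Continuous F := by
    simp only [F, c₀, c₁, c₂, c₃, a₂, b₂, linCoeff, quadCoeff]
    fun_prop
  obtain ⟨C, hC⟩ := ((isCompact_Icc (a := (0 : ℝ)) (b := 1)).prod
    ((isCompact_Icc (a := -A) (b := A)).prod
      (isCompact_Icc (a := -B) (b := B)))).exists_bound_of_continuousOn hF.continuousOn
  refine ⟨max C 1, by positivity, fun s κ K hs hκ hK => ?_⟩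
  have h := (le_abs_self _).trans ((hC (s, κ, K) ⟨hs, abs_le.1 hκ, abs_le.1 hK⟩).trans
    (le_max_left C 1))
  simp only [F] at h
  have hlin := abs_nonneg (linCoeff s κ K)
  have hquad := abs_nonneg (quadCoeff s κ K)
  have h₀ := abs_nonneg (c₀ s κ K)
  have h₁ := abs_nonneg (c₁ s κ K)
  have h₂ := abs_nonneg (c₂ s κ K)
  have h₃ := abs_nonneg (c₃ s κ K)
  refine ⟨by linarith, fun t ht => ?_⟩
  have hs₃ : 0 ≤ s ^ 3 := pow_nonneg hs.1 3
  have hT₀ : 1 ≤ (1 + t) ^ 3 := one_le_pow₀ (by linarith)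
  have hT₁ : t ≤ (1 + t) ^ 3 := by nlinarith [pow_nonneg ht 2, pow_nonneg ht 3]
  have hT₂ : t ^ 2 ≤ (1 + t) ^ 3 := by nlinarith [pow_nonneg ht 2, pow_nonneg ht 3]
  have hT₃ : t ^ 3 ≤ (1 + t) ^ 3 := by gcongr; linarith
  calc _ = |c₀ s κ K + c₁ s κ K * t + c₂ s κ K * t ^ 2 + c₃ s κ K * t ^ 3| * s ^ 3 := by
        conv_rhs => rw [← abs_of_nonneg hs₃, ← abs_mul]
        congr 1
        simp only [c₀, c₁, c₂, c₃, a₂, b₂, linCoeff, quadCoeff]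
        ring
    _ ≤ (|c₀ s κ K| + |c₁ s κ K| * t + |c₂ s κ K| * t ^ 2 + |c₃ s κ K| * t ^ 3) * s ^ 3 := by
        gcongr
        exact abs_cubic_le _ _ _ _ ht
    _ ≤ (|c₀ s κ K| * (1 + t) ^ 3 + |c₁ s κ K| * (1 + t) ^ 3 + |c₂ s κ K| * (1 + t) ^ 3
          + |c₃ s κ K| * (1 + t) ^ 3) * s ^ 3 := by
        gcongr
        exact le_mul_of_one_le_right h₀ hT₀
    _ = (|c₀ s κ K| + |c₁ s κ K| + |c₂ s κ K| + |c₃ s κ K|) * (1 + t) ^ 3 * s ^ 3 := by ring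
    _ ≤ _ := by
        gcongr
        linarith

lemma wt_eq (m κ K t : ℝ) : wt m κ K t = 1 + m⁻¹ * κ * t + m⁻¹ ^ 2 * K * t ^ 2 := by
  simp only [wt, div_eq_mul_inv, inv_pow]
  ring

lemma wt'_eq (m κ K t : ℝ) : wt' m κ K t = m⁻¹ * κ + 2 * m⁻¹ ^ 2 * K * t := by
  simp only [wt', div_eq_mul_inv, inv_pow]
  ring

lemma deriv_eq_zero_of_eq_const {f : ℝ → ℝ} {a c y : ℝ} (hf : ∀ x < a, f x = c) (hy : y < a) :
    deriv f y = 0 := by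
  have h : f =ᶠ[nhds y] fun _ => c := by
    filter_upwards [Iio_mem_nhds hy] with x hx using hf x hx
  rw [h.deriv_eq, deriv_const]

lemma wt'_div_wt_abs_le {A B m κ K t : ℝ} (hm : 1 ≤ m) (hκ : |κ| ≤ A) (hK : |K| ≤ B) (ht : 0 ≤ t)
    (hwt : 1 / 2 ≤ wt m κ K t) :
    |wt' m κ K t / wt m κ K t| ≤ (2 * A + 4 * B) * (1 + t) := by
  have hs₀ : 0 ≤ m⁻¹ := by positivity
  have hs₁ : m⁻¹ ≤ 1 := inv_le_one_of_one_le₀ hm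
  have hA : 0 ≤ A := (abs_nonneg κ).trans hκ
  have hB : 0 ≤ B := (abs_nonneg K).trans hK
  have h : |wt' m κ K t| ≤ A + 2 * B * t := by
    rw [wt'_eq]
    calc _ ≤ |m⁻¹ * κ| + |2 * m⁻¹ ^ 2 * K * t| := abs_add_le _ _
      _ = m⁻¹ * |κ| + 2 * m⁻¹ ^ 2 * |K| * t := by
        simp only [abs_mul, abs_of_nonneg hs₀, abs_of_nonneg ht, abs_pow, abs_two]
      _ ≤ 1 * A + 2 * 1 ^ 2 * B * t := by gcongr
      _ = _ := by ring
  rw [abs_div, abs_of_pos (by linarith : 0 < wt m κ K t), div_le_iff₀ (by linarith)]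
  have : 0 ≤ (2 * A + 4 * B) * (1 + t) := by positivity
  nlinarith [mul_nonneg hA ht]

lemma wt_le {A B m κ K t : ℝ} (hm : 1 ≤ m) (hκ : |κ| ≤ A) (hK : |K| ≤ B) (ht : 0 ≤ t) :
    wt m κ K t ≤ (1 + A + B) * (1 + t) ^ 2 := by
  have hs₀ : 0 ≤ m⁻¹ := by positivity
  have hs₁ : m⁻¹ ≤ 1 := inv_le_one_of_one_le₀ hm
  have hA : 0 ≤ A := (abs_nonneg κ).trans hκ
  have hB : 0 ≤ B := (abs_nonneg K).trans hK
  rw [wt_eq]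
  calc _ ≤ 1 + m⁻¹ * |κ| * t + m⁻¹ ^ 2 * |K| * t ^ 2 := by
        gcongr
        · exact le_abs_self κ
        · exact le_abs_self K
    _ ≤ 1 + 1 * A * t + 1 ^ 2 * B * t ^ 2 := by gcongr
    _ ≤ _ := by nlinarith [mul_nonneg hA ht, mul_nonneg hB ht, mul_nonneg hA (sq_nonneg t)]

/-- The terms of `L̂ v` containing derivatives of the cutoff are supported in `τ ≥ √m / 2`. -/
lemma abs_cutoff_terms_le {m r t D₁ D₂ D c P R b : ℝ} (hm : 1 ≤ m)
    (hr : r = (Real.sqrt m)⁻¹) (ht : 0 ≤ t) (hc : 0 ≤ c)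
    (hD₁ : |D₁| ≤ D) (hD₂ : |D₂| ≤ D) (hsupp₁ : t * r < 1 / 2 → D₁ = 0)
    (hsupp₂ : t * r < 1 / 2 → D₂ = 0)
    (hP : |P| ≤ c * (1 + t) ^ 2) (hR : |R| ≤ c * (1 + t) ^ 2) (hb : |b| ≤ c * (1 + t)) :
    |r ^ 2 * D₂ * P + 2 * r * D₁ * R + b * (r * D₁ * P)|
      ≤ 64 * D * (3 * c + c ^ 2) * (1 + t) ^ 9 * m⁻¹ ^ 3 := by
  have hm₀ : 0 < m := by linarith
  have hD : 0 ≤ D := (abs_nonneg _).trans hD₁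
  rcases lt_or_ge (t * r) (1 / 2) with h | h
  · rw [hsupp₁ h, hsupp₂ h]
    simp only [mul_zero, zero_mul, add_zero, abs_zero]
    positivity
  have hsqrt : 1 ≤ Real.sqrt m := Real.one_le_sqrt.2 hm
  have hr₀ : 0 ≤ r := by rw [hr]; positivity
  have hr₁ : r ≤ 1 := by rw [hr]; exact inv_le_one_of_one_le₀ hsqrt
  have hr₂ : r ^ 2 = m⁻¹ := by rw [hr, inv_pow, Real.sq_sqrt hm₀.le]
  have hone : 1 ≤ 64 * (1 + t) ^ 6 * m⁻¹ ^ 3 := by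
    have h₁ : (1 : ℝ) ≤ 2 * ((1 + t) * r) := by linarith
    calc (1 : ℝ) ≤ (2 * ((1 + t) * r)) ^ 6 := one_le_pow₀ h₁
      _ = 64 * (1 + t) ^ 6 * m⁻¹ ^ 3 := by rw [← hr₂]; ring
  have hT : 1 ≤ 1 + t := by linarith
  calc _ ≤ |r ^ 2 * D₂ * P| + |2 * r * D₁ * R| + |b * (r * D₁ * P)| :=
        (abs_add_le _ _).trans (add_le_add (abs_add_le _ _) le_rfl)
    _ = r ^ 2 * |D₂| * |P| + 2 * r * |D₁| * |R| + |b| * (r * |D₁| * |P|) := by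
        simp only [abs_mul, abs_of_nonneg hr₀, abs_pow, abs_two]
    _ ≤ 1 ^ 2 * D * (c * (1 + t) ^ 2) + 2 * 1 * D * (c * (1 + t) ^ 2)
          + (c * (1 + t)) * (1 * D * (c * (1 + t) ^ 2)) := by gcongr
    _ = (3 * D * c) * (1 + t) ^ 2 + D * c ^ 2 * (1 + t) ^ 3 := by ring
    _ ≤ (3 * D * c) * (1 + t) ^ 3 + D * c ^ 2 * (1 + t) ^ 3 := by
        gcongr
        norm_num
    _ = D * (3 * c + c ^ 2) * (1 + t) ^ 3 * 1 := by ring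
    _ ≤ D * (3 * c + c ^ 2) * (1 + t) ^ 3 * (64 * (1 + t) ^ 6 * m⁻¹ ^ 3) := by gcongr
    _ = _ := by ring

lemma norm_LhatD_quasimode_le {A B m₁ : ℝ} (hA : 0 < A) (hB : 0 < B) (hm₁ : 1 ≤ m₁)
    (hwt : ∀ m, m₁ ≤ m → ∀ κ K τ : ℝ, |κ| ≤ A → |K| ≤ B →
      τ ∈ Icc 0 (Real.sqrt m) → 1 / 2 ≤ wt m κ K τ)
    {χ : ℝ → ℝ} (hχ : ContDiff ℝ 2 χ) (hχ01 : ∀ τ, χ τ ∈ Icc (0 : ℝ) 1)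
    (hχ1 : ∀ τ : ℝ, τ ≤ 1 / 2 → χ τ = 1) :
    ∃ C : ℝ, 0 < C ∧ ∀ m κ K : ℝ, m₁ ≤ m → |κ| ≤ A → |K| ≤ B → ∀ τ ∈ Icc 0 (Real.sqrt m),
      ‖LhatD m κ K (quasimode χ m κ K) τ‖ ≤ C * (1 + τ) ^ 9 * Real.exp (-τ) * m⁻¹ ^ 3 := by
  have hχ' : ContDiff ℝ 1 (deriv χ) :=
    (contDiff_succ_iff_deriv.1 (show ContDiff ℝ (1 + 1) χ from by norm_num; exact hχ)).2.2
  have hd : Differentiable ℝ χ := hχ.differentiable two_ne_zero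
  have hd' : Differentiable ℝ (deriv χ) := hχ'.differentiable one_ne_zero
  have hc'' : Continuous (deriv (deriv χ)) := hχ'.continuous_deriv le_rfl
  obtain ⟨D₁, hD₁⟩ := (isCompact_Icc (a := (0 : ℝ)) (b := 1)).exists_bound_of_continuousOn
    hd'.continuous.continuousOn
  obtain ⟨D₂, hD₂⟩ := (isCompact_Icc (a := (0 : ℝ)) (b := 1)).exists_bound_of_continuousOn
    hc''.continuousOn
  obtain ⟨c, hc, hres⟩ := abs_expansion_residual_le (A := A) (B := B)
  set D := max D₁ D₂
  set c' := 3 * c + (2 * A + 4 * B)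
  have hD : 0 ≤ D := (norm_nonneg _).trans ((hD₁ 0 ⟨le_rfl, zero_le_one⟩).trans (le_max_left _ _))
  refine ⟨2 * c + 64 * D * (3 * c' + c' ^ 2), by positivity,
    fun m κ K hm hκ hK t ht => ?_⟩
  have hm1 : 1 ≤ m := hm₁.trans hm
  have hm₀ : 0 < m := by linarith
  have hs₁ : m⁻¹ ≤ 1 := inv_le_one_of_one_le₀ hm1
  have hs₀ : 0 ≤ m⁻¹ := by positivity
  have ht₀ := ht.1
  obtain ⟨hcoef, hQ⟩ := hres m⁻¹ κ K ⟨hs₀, hs₁⟩ hκ hK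
  specialize hQ t ht.1
  have hw := hwt m hm κ K t hκ hK ht
  have hb := wt'_div_wt_abs_le hm1 hκ hK ht₀ hw
  rw [LhatD_quasimode hd hd', Complex.norm_real, Real.norm_eq_abs]
  set α := linCoeff m⁻¹ κ K
  set β := quadCoeff m⁻¹ κ K
  set r := (Real.sqrt m)⁻¹ with hr
  rw [← wt_eq, ← wt'_eq] at hQ
  set b := wt' m κ K t / wt m κ K t with hbdef
  set P := 1 + α * t + β * t ^ 2 with hP
  set R := α + 2 * β * t - P with hR
  have hP_le : |P| ≤ c * (1 + t) ^ 2 := by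
    exact (abs_quadratic_le α β ht₀).trans (by gcongr)
  have hR_le : |R| ≤ 3 * c * (1 + t) ^ 2 := by
    have h₁ : |α + 2 * β * t| ≤ 2 * c * (1 + t) ^ 2 := by
      exact (abs_affine_le α β ht₀).trans (by gcongr)
    calc |R| ≤ |α + 2 * β * t| + |P| := abs_sub _ _
      _ ≤ _ := by linarith
  have hcc' : c ≤ c' := by simp only [c']; linarith
  have h3cc' : 3 * c ≤ c' := by simp only [c']; linarith
  have hbc' : 2 * A + 4 * B ≤ c' := by simp only [c']; linarith
  have hy : t * r ∈ Icc (0 : ℝ) 1 := by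
    have := Real.sqrt_pos.2 hm₀
    refine ⟨by positivity, ?_⟩
    rw [hr, ← div_eq_mul_inv, div_le_one this]
    exact ht.2
  have hderiv : ∀ y < (1 / 2 : ℝ), deriv χ y = 0 := fun y hy =>
    deriv_eq_zero_of_eq_const (fun x hx => hχ1 x hx.le) hy
  have hcut := abs_cutoff_terms_le (P := P) (R := R) (b := b) (c := c') hm1 hr ht₀ (by positivity)
    ((hD₁ _ hy).trans (le_max_left D₁ D₂)) ((hD₂ _ hy).trans (le_max_right D₁ D₂))
    (hderiv _) (fun h => deriv_eq_zero_of_eq_const hderiv h)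
    (hP_le.trans (by gcongr)) (hR_le.trans (by gcongr)) (hb.trans (by gcongr))
  have hmain : |-(2 * β) + 2 * (α + 2 * β * t) - b * R| ≤ 2 * c * (1 + t) ^ 9 * m⁻¹ ^ 3 := by
    have hw₀ : 0 < wt m κ K t := by linarith
    have heq : -(2 * β) + 2 * (α + 2 * β * t) - b * R
        = (wt m κ K t * (-(2 * β) + 2 * (α + 2 * β * t)) - wt' m κ K t * R) / wt m κ K t := by
      rw [hbdef]
      field_simp
    have hT : (1 + t) ^ 3 ≤ (1 + t) ^ 9 := pow_le_pow_right₀ (by linarith) (by norm_num)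
    have hQ' := hQ.trans (show c * (1 + t) ^ 3 * m⁻¹ ^ 3 ≤ c * (1 + t) ^ 9 * m⁻¹ ^ 3 by gcongr)
    have hX : 0 ≤ c * (1 + t) ^ 9 * m⁻¹ ^ 3 := by positivity
    rw [heq, abs_div, abs_of_pos hw₀, div_le_iff₀ hw₀]
    calc _ ≤ c * (1 + t) ^ 9 * m⁻¹ ^ 3 := hQ'
      _ = 2 * (c * (1 + t) ^ 9 * m⁻¹ ^ 3) * (1 / 2) := by ring
      _ ≤ 2 * (c * (1 + t) ^ 9 * m⁻¹ ^ 3) * wt m κ K t := by gcongr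
      _ = _ := by ring
  have hχt : |χ (t * r)| ≤ 1 := abs_le.2 ⟨by linarith [(hχ01 (t * r)).1], (hχ01 (t * r)).2⟩
  calc _ = |χ (t * r) * (-(2 * β) + 2 * (α + 2 * β * t) - b * R)
          - (r ^ 2 * deriv (deriv χ) (t * r) * P + 2 * r * deriv χ (t * r) * R
            + b * (r * deriv χ (t * r) * P))| * Real.exp (-t) := by
        conv_rhs => rw [← abs_of_pos (Real.exp_pos (-t)), ← abs_mul]
        congr 1
        simp only [cutoffProfile, cutoffProfileDeriv, cutoffProfileDeriv₂, hR, hP]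
        ring
    _ ≤ (1 * (2 * c * (1 + t) ^ 9 * m⁻¹ ^ 3)
          + 64 * D * (3 * c' + c' ^ 2) * (1 + t) ^ 9 * m⁻¹ ^ 3) * Real.exp (-t) := by
        gcongr
        refine (abs_sub _ _).trans (add_le_add ?_ hcut)
        rw [abs_mul]
        gcongr
    _ = _ := by ring

lemma exists_one_add_pow_mul_exp_le (n : ℕ) :
    ∃ C : ℝ, 0 < C ∧ ∀ t : ℝ, 0 ≤ t →
      (1 + t) ^ n * Real.exp (-t) ^ 2 ≤ C * Real.exp (-t) := by
  refine ⟨n.factorial * Real.exp 1, by positivity, fun t ht => ?_⟩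
  have h := Real.pow_div_factorial_le_exp (1 + t) (by linarith) n
  rw [div_le_iff₀ (by positivity)] at h
  calc _ ≤ Real.exp (1 + t) * n.factorial * Real.exp (-t) ^ 2 := by gcongr
    _ = n.factorial * (Real.exp (1 + t) * Real.exp (-t)) * Real.exp (-t) := by ring
    _ = _ := by rw [← Real.exp_add, add_neg_cancel_right]

/-- A function dominated by `e^{-τ}` on `(0, R]` has integral controlled by the same constant. -/
lemma setIntegral_le_of_le_mul_exp_neg {f : ℝ → ℝ} {M R : ℝ} (hM : 0 ≤ M)
    (hf₀ : ∀ τ ∈ Ioc 0 R, 0 ≤ f τ) (hf : ∀ τ ∈ Ioc 0 R, f τ ≤ M * Real.exp (-τ)) :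
    ∫ τ in Ioc 0 R, f τ ≤ M := by
  have hint : IntegrableOn (fun τ => M * Real.exp (-τ)) (Ioi (0 : ℝ)) :=
    (integrableOn_exp_neg_Ioi 0).const_mul _
  calc _ ≤ ∫ τ in Ioc 0 R, M * Real.exp (-τ) := by
        refine integral_mono_of_nonneg ?_ (hint.mono_set Ioc_subset_Ioi_self) ?_
        · filter_upwards [ae_restrict_mem measurableSet_Ioc] with τ hτ using hf₀ τ hτ
        · filter_upwards [ae_restrict_mem measurableSet_Ioc] with τ hτ using hf τ hτ
    _ ≤ ∫ τ in Ioi (0 : ℝ), M * Real.exp (-τ) :=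
        setIntegral_mono_set hint (Filter.Eventually.of_forall fun τ => by
          simp only [Pi.zero_apply]; positivity) Ioc_subset_Ioi_self.eventuallyLE
    _ = M := by rw [integral_const_mul, integral_exp_neg_Ioi_zero, mul_one]

/-- Properties of the quasimode: admissibility, value of the derivative at the origin,
and smallness of `L̂_{m,κ,K} v_m` in the weighted `L²` norm. -/
theorem quasimode_properties (A B m₁ : ℝ) (hA : 0 < A) (hB : 0 < B) (hm₁ : 1 ≤ m₁)
    (hwt : ∀ m, m₁ ≤ m → ∀ κ K τ : ℝ, |κ| ≤ A → |K| ≤ B →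
      τ ∈ Icc 0 (Real.sqrt m) → 1 / 2 ≤ wt m κ K τ)
    (χ : ℝ → ℝ) (hχ : ContDiff ℝ (⊤ : ℕ∞) χ) (hχ01 : ∀ τ, χ τ ∈ Icc (0 : ℝ) 1)
    (hχ1 : ∀ τ : ℝ, τ ≤ 1 / 2 → χ τ = 1) (hχ0 : ∀ τ : ℝ, 1 ≤ τ → χ τ = 0) :
    ∃ C : ℝ, 0 < C ∧ ∀ m κ K : ℝ, m₁ ≤ m → |κ| ≤ A → |K| ≤ B →
      Adm m (quasimode χ m κ K) (deriv (quasimode χ m κ K)) ∧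
      -(deriv (quasimode χ m κ K) 0)
        = ((1 + κ / (2 * m) + (K / 2 - κ ^ 2 / 8) / m ^ 2 : ℝ) : ℂ) ∧
      Real.sqrt (∫ τ in Ioc (0 : ℝ) (Real.sqrt m),
          ‖LhatD m κ K (quasimode χ m κ K) τ‖ ^ 2 * wt m κ K τ)
        ≤ C / m ^ 3 := by
  have hχ2 : ContDiff ℝ 2 χ := contDiff_infty.1 hχ 2
  have hd : Differentiable ℝ χ := hχ2.differentiable two_ne_zero
  obtain ⟨c, hc, hL⟩ := norm_LhatD_quasimode_le hA hB hm₁ hwt hχ2 hχ01 hχ1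
  obtain ⟨c', hc', hexp⟩ := exists_one_add_pow_mul_exp_le 20
  set M := c ^ 2 * (1 + A + B) * c' with hM
  have hM₀ : 0 < M := by positivity
  refine ⟨Real.sqrt M, Real.sqrt_pos.2 hM₀, fun m κ K hm hκ hK => ⟨?_, ?_, ?_⟩⟩
  · exact adm_quasimode (hχ2.of_le one_le_two) (hχ1 0 (by norm_num)) (hχ0 1 le_rfl)
      (by linarith) κ K
  · have hχ'0 : deriv χ 0 = 0 :=
      deriv_eq_zero_of_eq_const (fun x hx => hχ1 x hx.le) (by norm_num : (0 : ℝ) < 1 / 2)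
    rw [deriv_quasimode hd, ← Complex.ofReal_neg]
    congr 1
    simp only [cutoffProfileDeriv, linCoeff, zero_mul, hχ'0, hχ1 0 (by norm_num), neg_zero,
      Real.exp_zero, div_eq_mul_inv, mul_inv, inv_pow]
    ring
  · have hm₀ : 0 < m := by linarith
    have hle : ∫ τ in Ioc (0 : ℝ) (Real.sqrt m),
        ‖LhatD m κ K (quasimode χ m κ K) τ‖ ^ 2 * wt m κ K τ ≤ M * m⁻¹ ^ 6 := by
      have hw : ∀ τ ∈ Ioc 0 (Real.sqrt m), 0 ≤ wt m κ K τ := fun τ hτ => by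
        linarith [hwt m hm κ K τ hκ hK (Ioc_subset_Icc_self hτ)]
      refine setIntegral_le_of_le_mul_exp_neg (by positivity)
        (fun τ hτ => mul_nonneg (sq_nonneg _) (hw τ hτ)) (fun τ hτ => ?_)
      calc _ ≤ (c * (1 + τ) ^ 9 * Real.exp (-τ) * m⁻¹ ^ 3) ^ 2
            * ((1 + A + B) * (1 + τ) ^ 2) :=
            mul_le_mul (pow_le_pow_left₀ (norm_nonneg _)
              (hL m κ K hm hκ hK τ (Ioc_subset_Icc_self hτ)) 2)
              (wt_le (hm₁.trans hm) hκ hK hτ.1.le) (hw τ hτ) (sq_nonneg _)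
        _ = c ^ 2 * (1 + A + B) * m⁻¹ ^ 6 * ((1 + τ) ^ 20 * Real.exp (-τ) ^ 2) := by ring
        _ ≤ c ^ 2 * (1 + A + B) * m⁻¹ ^ 6 * (c' * Real.exp (-τ)) :=
            mul_le_mul_of_nonneg_left (hexp τ hτ.1.le) (by positivity)
        _ = _ := by rw [hM]; ring
    calc _ ≤ Real.sqrt (M * m⁻¹ ^ 6) := Real.sqrt_le_sqrt hle
      _ = Real.sqrt M / m ^ 3 := by
          rw [Real.sqrt_mul hM₀.le, show m⁻¹ ^ 6 = (m⁻¹ ^ 3) ^ 2 by ring,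
            Real.sqrt_sq (by positivity), inv_pow, div_eq_mul_inv]
end

section
/- There exists a constant C > 0 such that for all (m, κ, K) ∈ [m₁, ∞) × [−A, A] × [−B, B], the unique minimizer u_{m,κ,K} of Q̂_{m,κ,K} over V̂_{m,κ,K} satisfies |∫₀^{√m} |u_{m,κ,K}(τ)|² a_{m,κ,K}(τ) dτ − 1/2| ≤ C m⁻¹. -/
open Set MeasureTheory

/-- The weighted energy `Q̂_{m,κ,K}(u) = ∫₀^{√m} (|u'|² + |u|²) a_{m,κ,K} dτ`. -/
noncomputable def energy (m κ K : ℝ) (u g : ℝ → ℂ) : ℝ :=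
  ∫ τ in Ioc (0 : ℝ) (Real.sqrt m), (‖g τ‖ ^ 2 + ‖u τ‖ ^ 2) * wt m κ K τ

/-- `Λ_{m,κ,K}`, the infimum of the energy over the admissible set. -/
noncomputable def lam (m κ K : ℝ) : ℝ :=
  sInf {E : ℝ | ∃ u g : ℝ → ℂ, Adm m u g ∧ E = energy m κ K u g}

/-- The solution `sinh (R - τ) / sinh R` of `v'' = v`, `v 0 = 1`, `v R = 0`. -/
noncomputable def sinhProfile (R τ : ℝ) : ℝ := Real.sinh (R - τ) / Real.sinh R

/-- The derivative of `sinhProfile R`. -/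
noncomputable def coshProfile (R τ : ℝ) : ℝ := -Real.cosh (R - τ) / Real.sinh R

lemma hasDerivAt_sinhProfile (R τ : ℝ) :
    HasDerivAt (sinhProfile R) (coshProfile R τ) τ := by
  have h := (((hasDerivAt_id τ).const_sub R).sinh).div_const (Real.sinh R)
  exact h.congr_deriv (by simp [coshProfile])

lemma hasDerivAt_coshProfile (R τ : ℝ) :
    HasDerivAt (coshProfile R) (sinhProfile R τ) τ := by
  have h := ((((hasDerivAt_id τ).const_sub R).cosh).neg).div_const (Real.sinh R)
  exact h.congr_deriv (by simp [sinhProfile])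

lemma continuous_sinhProfile (R : ℝ) : Continuous (sinhProfile R) :=
  continuous_iff_continuousAt.2 fun τ => (hasDerivAt_sinhProfile R τ).continuousAt

lemma continuous_coshProfile (R : ℝ) : Continuous (coshProfile R) :=
  continuous_iff_continuousAt.2 fun τ => (hasDerivAt_coshProfile R τ).continuousAt

lemma contDiff_coshProfile (R : ℝ) : ContDiff ℝ 1 (coshProfile R) := by
  unfold coshProfile
  fun_prop

lemma sinhProfile_zero {R : ℝ} (hR : 0 < R) : sinhProfile R 0 = 1 := by
  have := Real.sinh_pos_iff.2 hR
  simp [sinhProfile, this.ne']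

lemma sinhProfile_self (R : ℝ) : sinhProfile R R = 0 := by simp [sinhProfile]

lemma exp_div_four_le_sinh {R : ℝ} (hR : 1 ≤ R) : Real.exp R / 4 ≤ Real.sinh R := by
  have h1 := Real.add_one_le_exp R
  have h2 : Real.exp (-R) ≤ 1 := Real.exp_le_one_iff.2 (by linarith)
  rw [Real.sinh_eq]
  linarith

lemma sinhProfile_nonneg {R τ : ℝ} (hR : 1 ≤ R) (hτ : τ ≤ R) : 0 ≤ sinhProfile R τ :=
  div_nonneg (Real.sinh_nonneg_iff.2 (by linarith)) (Real.sinh_nonneg_iff.2 (by linarith))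

lemma sinhProfile_le_exp {R τ : ℝ} (hR : 1 ≤ R) (hτ : 0 ≤ τ) :
    sinhProfile R τ ≤ Real.exp (-τ) := by
  have hS : 0 < Real.sinh R := Real.sinh_pos_iff.2 (by linarith)
  rw [sinhProfile, div_le_iff₀ hS, Real.sinh_eq, Real.sinh_eq]
  have e1 : Real.exp (-τ) * Real.exp R = Real.exp (R - τ) := by
    rw [← Real.exp_add]; ring_nf
  have e2 : Real.exp (-τ) * Real.exp (-R) = Real.exp (-τ - R) := by
    rw [← Real.exp_add]; ring_nf
  have e3 : Real.exp (-τ - R) ≤ Real.exp (-(R - τ)) := Real.exp_le_exp.2 (by linarith)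
  linarith

lemma abs_coshProfile_le_exp {R τ : ℝ} (hR : 1 ≤ R) (hτ : τ ≤ R) :
    |coshProfile R τ| ≤ 4 * Real.exp (-τ) := by
  have hS : 0 < Real.sinh R := Real.sinh_pos_iff.2 (by linarith)
  rw [coshProfile, abs_div, abs_neg, abs_of_pos (Real.cosh_pos _), abs_of_pos hS,
    div_le_iff₀ hS]
  have e1 : Real.exp (-τ) * Real.exp R = Real.exp (R - τ) := by
    rw [← Real.exp_add]; ring_nf
  have e3 : Real.exp (-(R - τ)) ≤ Real.exp (R - τ) := Real.exp_le_exp.2 (by linarith)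
  have h4 := mul_le_mul_of_nonneg_left (exp_div_four_le_sinh hR) (Real.exp_pos (-τ)).le
  rw [Real.cosh_eq]
  linarith

lemma abs_integral_sinhProfile_sq_sub_half_le {R : ℝ} (hR : 1 ≤ R) :
    |(∫ τ in Ioc 0 R, sinhProfile R τ ^ 2) - 1 / 2| ≤ 18 / R ^ 2 := by
  have hS : 0 < Real.sinh R := Real.sinh_pos_iff.2 (by linarith)
  have hder : ∀ τ ∈ uIcc 0 R, HasDerivAt
      (fun τ => (sinhProfile R τ * coshProfile R τ - τ / Real.sinh R ^ 2) / 2)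
      (sinhProfile R τ ^ 2) τ := by
    intro τ _
    have h := (((hasDerivAt_sinhProfile R τ).mul (hasDerivAt_coshProfile R τ)).sub
      ((hasDerivAt_id τ).div_const (Real.sinh R ^ 2))).div_const 2
    refine h.congr_deriv ?_
    simp only [sinhProfile, coshProfile]
    have := Real.cosh_sq (R - τ)
    field_simp
    rw [this]
    ring
  have hint := intervalIntegral.integral_eq_sub_of_hasDerivAt hder
    (((continuous_sinhProfile R).pow 2).intervalIntegrable 0 R)
  rw [← intervalIntegral.integral_of_le (by linarith), hint, sinhProfile_self,
    sinhProfile_zero (by linarith), show coshProfile R 0 = -Real.cosh R / Real.sinh R by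
      simp [coshProfile]]
  have hc : Real.cosh R = Real.sinh R + Real.exp (-R) := by
    rw [Real.sinh_eq, Real.cosh_eq]; ring
  have heq : (0 * coshProfile R R - R / Real.sinh R ^ 2) / 2
      - (1 * (-Real.cosh R / Real.sinh R) - 0 / Real.sinh R ^ 2) / 2 - 1 / 2
      = (Real.exp (-R) / Real.sinh R - R / Real.sinh R ^ 2) / 2 := by
    rw [hc]; field_simp; ring
  have hE := exp_div_four_le_sinh hR
  have hq := Real.quadratic_le_exp_of_nonneg (show (0 : ℝ) ≤ R by linarith)
  have b1 : Real.exp (-R) / Real.sinh R ≤ 4 / R ^ 2 := by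
    rw [Real.exp_neg, ← one_div, div_div, div_le_div_iff₀ (by positivity) (by positivity)]
    have h1 : R ≤ Real.exp R := by nlinarith
    nlinarith
  have b2 : R / Real.sinh R ^ 2 ≤ 32 / R ^ 2 := by
    rw [div_le_div_iff₀ (by positivity) (by positivity)]
    have h1 : R ≤ Real.exp R := by nlinarith
    have h2 : R ^ 2 / 2 ≤ Real.exp R := by nlinarith
    have h3 : R ^ 2 / 2 * R ≤ Real.exp R * Real.exp R :=
      mul_le_mul h2 h1 (by linarith) (Real.exp_pos R).le
    have h4 : (Real.exp R / 4) ^ 2 ≤ Real.sinh R ^ 2 := by gcongr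
    nlinarith
  have b3 : 0 ≤ Real.exp (-R) / Real.sinh R := by positivity
  have b4 : 0 ≤ R / Real.sinh R ^ 2 := by positivity
  have b5 : 4 / R ^ 2 + 32 / R ^ 2 = 2 * (18 / R ^ 2) := by ring
  rw [heq, abs_le]
  constructor <;> linarith

lemma integral_mul_add_deriv_mul_primitive {φ φ' k : ℝ → ℝ} {R : ℝ}
    (hφ : ContDiff ℝ 1 φ) (hφ' : ∀ x, HasDerivAt φ (φ' x) x)
    (hk : IntervalIntegrable k volume 0 R) :
    ∫ x in (0 : ℝ)..R, φ' x * (∫ t in (0 : ℝ)..x, k t) + φ x * k x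
      = φ R * ∫ t in (0 : ℝ)..R, k t := by
  have h1 : AbsolutelyContinuousOnInterval φ 0 R :=
    hφ.contDiffOn.absolutelyContinuousOnInterval
  have h2 := hk.absolutelyContinuousOnInterval_intervalIntegral (c := 0) (by simp)
  have h3 := h1.integral_deriv_mul_eq_sub h2
  rw [intervalIntegral.integral_same, mul_zero, sub_zero] at h3
  rw [← h3]
  apply intervalIntegral.integral_congr_ae
  filter_upwards [hk.ae_hasDerivAt_integral] with x hx hxR
  rw [(hφ' x).deriv, (hx (uIoc_subset_uIcc hxR) 0 (by simp)).deriv]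

lemma isH1On_sinhProfile {R : ℝ} :
    IsH1On R (fun τ => (sinhProfile R τ : ℂ)) (fun τ => (coshProfile R τ : ℂ)) := by
  constructor
  · have hc : Continuous fun τ => (coshProfile R τ : ℂ) :=
      Complex.continuous_ofReal.comp (continuous_coshProfile R)
    obtain ⟨C, hC⟩ := isCompact_Icc.exists_bound_of_continuousOn (hc.continuousOn (s := Icc 0 R))
    refine MemLp.of_bound hc.aestronglyMeasurable C ?_
    filter_upwards [ae_restrict_mem measurableSet_Ioc] with x hx
    exact hC x (Ioc_subset_Icc_self hx)
  · intro x hx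
    rw [integral_complex_ofReal, ← intervalIntegral.integral_of_le hx.1,
      intervalIntegral.integral_eq_sub_of_hasDerivAt (fun τ _ => hasDerivAt_sinhProfile R τ)
        ((continuous_coshProfile R).intervalIntegrable 0 x)]
    push_cast
    ring

lemma adm_sinhProfile {m : ℝ} (hm : 0 < m) :
    Adm m (fun τ => (sinhProfile √m τ : ℂ)) (fun τ => (coshProfile √m τ : ℂ)) :=
  ⟨isH1On_sinhProfile, by simp [sinhProfile_zero (Real.sqrt_pos.2 hm)],
    by simp [sinhProfile_self]⟩

lemma IsH1On.integrableOn {R : ℝ} {u g : ℝ → ℂ} (h : IsH1On R u g) :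
    IntegrableOn g (Ioc 0 R) :=
  h.1.integrable one_le_two

lemma IsH1On.continuousOn {R : ℝ} {u g : ℝ → ℂ} (h : IsH1On R u g) :
    ContinuousOn u (Icc 0 R) := by
  have h1 := intervalIntegral.continuousOn_primitive
    ((integrableOn_Icc_iff_integrableOn_Ioc (by simp)).2 h.integrableOn)
  exact (continuousOn_const.add h1).congr h.2

/-- Euler–Lagrange equation of the unweighted problem tested against the real part of an
admissible variation. -/
lemma integral_coshProfile_mul_add_eq_zero {R : ℝ} {u g : ℝ → ℂ} (hR : 0 < R)
    (h : IsH1On R u g) (h0 : u 0 = 1) (h1 : u R = 0) :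
    ∫ τ in Ioc 0 R, (sinhProfile R τ * ((u τ).re - sinhProfile R τ)
      + coshProfile R τ * ((g τ).re - coshProfile R τ)) = 0 := by
  have hg : IntervalIntegrable (fun τ => (g τ).re) volume 0 R :=
    (intervalIntegrable_iff_integrableOn_Ioc_of_le hR.le).2 h.integrableOn.re
  have hk : IntervalIntegrable (fun τ => (g τ).re - coshProfile R τ) volume 0 R :=
    hg.sub ((continuous_coshProfile R).intervalIntegrable 0 R)
  have hprim : ∀ x ∈ Icc 0 R,
      ∫ t in (0 : ℝ)..x, ((g t).re - coshProfile R t) = (u x).re - sinhProfile R x := by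
    intro x hx
    have hsub : uIcc 0 x ⊆ uIcc 0 R := by
      rw [uIcc_of_le hx.1, uIcc_of_le hR.le]
      exact Icc_subset_Icc_right hx.2
    rw [intervalIntegral.integral_sub (hg.mono_set hsub)
      ((continuous_coshProfile R).intervalIntegrable 0 x),
      intervalIntegral.integral_eq_sub_of_hasDerivAt (fun τ _ => hasDerivAt_sinhProfile R τ)
        ((continuous_coshProfile R).intervalIntegrable 0 x), h.2 x hx, h0,
      intervalIntegral.integral_of_le hx.1, sinhProfile_zero hR]
    have := integral_re (𝕜 := ℂ)
      (h.integrableOn.mono_set (Ioc_subset_Ioc_right hx.2))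
    simp only [RCLike.re_eq_complex_re] at this
    rw [this]
    simp
    ring
  have key := integral_mul_add_deriv_mul_primitive (contDiff_coshProfile R)
    (hasDerivAt_coshProfile R) hk
  rw [hprim R (right_mem_Icc.2 hR.le), h1, sinhProfile_self] at key
  simp only [Complex.zero_re, sub_zero, mul_zero] at key
  rw [intervalIntegral.integral_of_le hR.le] at key
  refine (setIntegral_congr_fun measurableSet_Ioc fun x hx => ?_).trans key
  simp only [hprim x (Ioc_subset_Icc_self hx)]

lemma integral_exp_neg_Ioc_le_one {R : ℝ} (hR : 0 ≤ R) :
    ∫ τ in Ioc 0 R, Real.exp (-τ) ≤ 1 := by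
  have h : ∀ τ ∈ uIcc 0 R, HasDerivAt (fun τ => -Real.exp (-τ)) (Real.exp (-τ)) τ := by
    intro τ _
    exact (((hasDerivAt_id τ).neg.exp).neg).congr_deriv (by simp)
  rw [← intervalIntegral.integral_of_le hR, intervalIntegral.integral_eq_sub_of_hasDerivAt h
    (Continuous.intervalIntegrable (by fun_prop) 0 R)]
  have := Real.exp_pos (-R)
  simp
  linarith

lemma continuous_wt (m κ K : ℝ) : Continuous (wt m κ K) := by
  unfold wt
  fun_prop

lemma abs_wt_sub_one_le {m κ K A B τ : ℝ} (hm : 1 ≤ m) (hκ : |κ| ≤ A) (hK : |K| ≤ B)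
    (hτ : 0 ≤ τ) : |wt m κ K τ - 1| ≤ (2 * A + 8 * B) / m * Real.exp (τ / 2) := by
  have hq := Real.quadratic_le_exp_of_nonneg (show 0 ≤ τ / 2 by linarith)
  have hA : 0 ≤ A := (abs_nonneg κ).trans hκ
  have hB : 0 ≤ B := (abs_nonneg K).trans hK
  have h1 : |τ * κ / m| ≤ τ * A / m := by
    rw [abs_div, abs_mul, abs_of_nonneg hτ, abs_of_pos (by linarith : 0 < m)]
    gcongr
  have h2 : |τ ^ 2 * K / m ^ 2| ≤ τ ^ 2 * B / m := by
    rw [abs_div, abs_mul, abs_of_nonneg (sq_nonneg τ), abs_of_nonneg (sq_nonneg m)]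
    gcongr
    nlinarith
  have h3 : wt m κ K τ - 1 = τ * κ / m + τ ^ 2 * K / m ^ 2 := by unfold wt; ring
  have h4 : τ ≤ 2 * Real.exp (τ / 2) := by nlinarith
  have h5 : τ ^ 2 ≤ 8 * Real.exp (τ / 2) := by nlinarith
  calc |wt m κ K τ - 1| ≤ τ * A / m + τ ^ 2 * B / m := by
        rw [h3]; exact (abs_add_le _ _).trans (add_le_add h1 h2)
    _ ≤ (2 * Real.exp (τ / 2)) * A / m + (8 * Real.exp (τ / 2)) * B / m := by gcongr
    _ = _ := by ring

lemma integrableOn_mul_continuous {f c : ℝ → ℝ} {R : ℝ} (hf : IntegrableOn f (Ioc 0 R))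
    (hc : Continuous c) : IntegrableOn (fun τ => f τ * c τ) (Ioc 0 R) := by
  rw [← integrableOn_Icc_iff_integrableOn_Ioc (by finiteness)] at hf ⊢
  exact hf.mul_continuousOn hc.continuousOn isCompact_Icc

lemma energy_nonneg {m κ K : ℝ} (hw : ∀ τ ∈ Ioc 0 √m, 0 ≤ wt m κ K τ) (u g : ℝ → ℂ) :
    0 ≤ energy m κ K u g :=
  setIntegral_nonneg measurableSet_Ioc fun τ hτ => mul_nonneg (by positivity) (hw τ hτ)

lemma lam_le_energy {m κ K : ℝ} (hw : ∀ τ ∈ Ioc 0 √m, 0 ≤ wt m κ K τ) {u g : ℝ → ℂ}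
    (h : Adm m u g) : lam m κ K ≤ energy m κ K u g := by
  refine csInf_le ⟨0, ?_⟩ ⟨u, g, h, rfl⟩
  rintro E ⟨u', g', -, rfl⟩
  exact energy_nonneg hw u' g'

lemma half_sq_mul_le_energy_density_sub (u g : ℂ) {v d w : ℝ} (hw : 1 / 2 ≤ w) :
    ‖u - v‖ ^ 2 * w / 2 ≤ (‖g‖ ^ 2 + ‖u‖ ^ 2) * w - (d ^ 2 + v ^ 2) * w
      - 2 * (v * (u.re - v) + d * (g.re - d)) + 4 * (d ^ 2 + v ^ 2) * (w - 1) ^ 2 := by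
  simp only [Complex.sq_norm, Complex.normSq_apply, Complex.sub_re, Complex.sub_im,
    Complex.ofReal_re, Complex.ofReal_im, sub_zero]
  obtain ⟨a, ha⟩ : ∃ a, a = u.re - v := ⟨_, rfl⟩
  obtain ⟨b, hb⟩ : ∃ b, b = g.re - d := ⟨_, rfl⟩
  have hu : u.re = a + v := by linarith
  have hg : g.re = b + d := by linarith
  rw [hu, hg]
  have e1 := sq_nonneg (a / 2 + 2 * v * (w - 1))
  have e2 := sq_nonneg (b / 2 + 2 * d * (w - 1))
  have e3 : 0 ≤ (w - 1 / 2) * (a ^ 2 / 2) := mul_nonneg (by linarith) (by positivity)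
  have e4 : 0 ≤ (w - 1 / 2) * b ^ 2 := mul_nonneg (by linarith) (by positivity)
  have e5 : 0 ≤ w * u.im ^ 2 := mul_nonneg (by linarith) (by positivity)
  have e6 : 0 ≤ w * g.im ^ 2 := mul_nonneg (by linarith) (by positivity)
  nlinarith [sq_nonneg b]

lemma abs_sq_mul_sub_sq_le (u : ℂ) {v w m : ℝ} (hw : 0 ≤ w) (hm : 1 ≤ m) :
    |‖u‖ ^ 2 * w - v ^ 2| ≤ 2 * m * (‖u - v‖ ^ 2 * w) + v ^ 2 * w / m + v ^ 2 * |w - 1| := by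
  simp only [Complex.sq_norm, Complex.normSq_apply, Complex.sub_re, Complex.sub_im,
    Complex.ofReal_re, Complex.ofReal_im, sub_zero]
  obtain ⟨a, ha⟩ : ∃ a, a = u.re - v := ⟨_, rfl⟩
  have hu : u.re = a + v := by linarith
  rw [hu]
  have hm0 : 0 < m := by linarith
  have e1 : |2 * (v * a)| ≤ m * a ^ 2 + v ^ 2 / m := by
    have p : (m * a + v) ^ 2 / m = m * a ^ 2 + v ^ 2 / m + 2 * (v * a) := by field_simp; ring
    have q : (m * a - v) ^ 2 / m = m * a ^ 2 + v ^ 2 / m - 2 * (v * a) := by field_simp; ring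
    have p' : 0 ≤ (m * a + v) ^ 2 / m := by positivity
    have q' : 0 ≤ (m * a - v) ^ 2 / m := by positivity
    rw [abs_le]
    constructor <;> linarith
  have hdec : ((a + v) * (a + v) + u.im * u.im) * w - v ^ 2
      = 2 * (v * a) * w + (a ^ 2 + u.im ^ 2) * w + v ^ 2 * (w - 1) := by ring
  rw [hdec]
  refine (abs_add_three _ _ _).trans ?_
  rw [abs_mul, abs_mul _ w, abs_mul _ (w - 1), abs_of_nonneg hw, abs_of_nonneg (sq_nonneg v),
    abs_of_nonneg (by positivity : 0 ≤ a ^ 2 + u.im ^ 2)]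
  have e2 := mul_le_mul_of_nonneg_right e1 hw
  have e3 : 0 ≤ (m - 1) * ((a ^ 2 + u.im ^ 2) * w) := mul_nonneg (by linarith) (by positivity)
  have e4 : 0 ≤ m * u.im ^ 2 * w := by positivity
  have e5 : (m * a ^ 2 + v ^ 2 / m) * w = m * a ^ 2 * w + v ^ 2 * w / m := by ring
  have e6 : (a + v - v) = a := by ring
  rw [e6]
  nlinarith

lemma IsH1On.integrableOn_sq_deriv {R : ℝ} {u g : ℝ → ℂ} (h : IsH1On R u g) :
    IntegrableOn (fun τ => ‖g τ‖ ^ 2) (Ioc 0 R) :=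
  h.1.integrable_norm_pow two_ne_zero

lemma integrableOn_of_continuousOn {f : ℝ → ℝ} {R : ℝ} (h : ContinuousOn f (Icc 0 R)) :
    IntegrableOn f (Ioc 0 R) :=
  h.integrableOn_Icc.mono_set Ioc_subset_Icc_self

/-- The weighted `L²` distance between an admissible function of energy at most that of
`sinhProfile` and `sinhProfile`. -/
lemma integral_norm_sub_sinhProfile_sq_le {m κ K A B : ℝ} {u g : ℝ → ℂ} (hm : 1 ≤ m)
    (hκ : |κ| ≤ A) (hK : |K| ≤ B) (hw : ∀ τ ∈ Ioc 0 √m, 1 / 2 ≤ wt m κ K τ)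
    (hu : Adm m u g) (hmin : energy m κ K u g = lam m κ K) :
    ∫ τ in Ioc 0 √m, ‖u τ - sinhProfile √m τ‖ ^ 2 * wt m κ K τ
      ≤ 136 * ((2 * A + 8 * B) / m) ^ 2 := by
  obtain ⟨hH, h0, h1⟩ := hu
  have hR : 1 ≤ √m := Real.one_le_sqrt.2 hm
  have hR0 : 0 < √m := by linarith
  set R := √m with hRdef
  set M := (2 * A + 8 * B) / m with hM
  have hwc := continuous_wt m κ K
  have hvc := continuous_sinhProfile R
  have hdc := continuous_coshProfile R
  have huc := hH.continuousOn
  have iX : IntegrableOn (fun τ => ‖u τ - sinhProfile R τ‖ ^ 2 * wt m κ K τ / 2) (Ioc 0 R) :=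
    integrableOn_of_continuousOn (by
      have : ContinuousOn (fun τ => (sinhProfile R τ : ℂ)) (Icc 0 R) :=
        (Complex.continuous_ofReal.comp hvc).continuousOn
      exact ((((huc.sub this).norm.pow 2).mul hwc.continuousOn).div_const 2))
  have iU : IntegrableOn (fun τ => (‖g τ‖ ^ 2 + ‖u τ‖ ^ 2) * wt m κ K τ) (Ioc 0 R) :=
    integrableOn_mul_continuous
      (hH.integrableOn_sq_deriv.add (integrableOn_of_continuousOn (huc.norm.pow 2))) hwc
  have iV : IntegrableOn (fun τ => (coshProfile R τ ^ 2 + sinhProfile R τ ^ 2) * wt m κ K τ)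
      (Ioc 0 R) := integrableOn_of_continuousOn (by fun_prop)
  have iC : IntegrableOn (fun τ => 2 * (sinhProfile R τ * ((u τ).re - sinhProfile R τ)
      + coshProfile R τ * ((g τ).re - coshProfile R τ))) (Ioc 0 R) := by
    have hre : IntegrableOn (fun τ => (g τ).re) (Ioc 0 R) := hH.integrableOn.re
    have a1 : IntegrableOn (fun τ => (coshProfile R τ * ((g τ).re - coshProfile R τ)))
        (Ioc 0 R) := by
      have := integrableOn_mul_continuous
        (hre.sub (integrableOn_of_continuousOn (R := R) hdc.continuousOn)) hdc
      exact this.congr_fun (fun τ _ => by simp [mul_comm]) measurableSet_Ioc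
    have a2 : IntegrableOn (fun τ => sinhProfile R τ * ((u τ).re - sinhProfile R τ))
        (Ioc 0 R) := integrableOn_of_continuousOn
      (hvc.continuousOn.mul ((Complex.continuous_re.comp_continuousOn huc).sub hvc.continuousOn))
    exact (a2.add a1).const_mul 2
  have iE : IntegrableOn (fun τ => 68 * M ^ 2 * Real.exp (-τ)) (Ioc 0 R) :=
    integrableOn_of_continuousOn (by fun_prop)
  have hpt : ∀ τ ∈ Ioc 0 R, ‖u τ - sinhProfile R τ‖ ^ 2 * wt m κ K τ / 2
      ≤ (‖g τ‖ ^ 2 + ‖u τ‖ ^ 2) * wt m κ K τ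
        - (coshProfile R τ ^ 2 + sinhProfile R τ ^ 2) * wt m κ K τ
        - 2 * (sinhProfile R τ * ((u τ).re - sinhProfile R τ)
          + coshProfile R τ * ((g τ).re - coshProfile R τ))
        + 68 * M ^ 2 * Real.exp (-τ) := by
    intro τ hτ
    refine (half_sq_mul_le_energy_density_sub (u τ) (g τ) (v := sinhProfile R τ)
      (d := coshProfile R τ) (hw τ hτ)).trans ?_
    refine add_le_add_right ?_ _
    have b1 : coshProfile R τ ^ 2 ≤ (4 * Real.exp (-τ)) ^ 2 :=
      sq_le_sq' (abs_le.1 (abs_coshProfile_le_exp hR hτ.2)).1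
        (abs_le.1 (abs_coshProfile_le_exp hR hτ.2)).2
    have b2 : sinhProfile R τ ^ 2 ≤ Real.exp (-τ) ^ 2 :=
      pow_le_pow_left₀ (sinhProfile_nonneg hR hτ.2) (sinhProfile_le_exp hR hτ.1.le) 2
    have hb := abs_le.1 (abs_wt_sub_one_le hm hκ hK hτ.1.le)
    have b3 : (wt m κ K τ - 1) ^ 2 ≤ (M * Real.exp (τ / 2)) ^ 2 := sq_le_sq' hb.1 hb.2
    have e1 : Real.exp (-τ) ^ 2 * Real.exp (τ / 2) ^ 2 = Real.exp (-τ) := by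
      rw [← Real.exp_nat_mul, ← Real.exp_nat_mul, ← Real.exp_add]
      congr 1
      push_cast
      ring
    calc 4 * (coshProfile R τ ^ 2 + sinhProfile R τ ^ 2) * (wt m κ K τ - 1) ^ 2
        ≤ 4 * ((4 * Real.exp (-τ)) ^ 2 + Real.exp (-τ) ^ 2) * (M * Real.exp (τ / 2)) ^ 2 := by
          gcongr
      _ = 68 * M ^ 2 * (Real.exp (-τ) ^ 2 * Real.exp (τ / 2) ^ 2) := by ring
      _ = _ := by rw [e1]
  have hint := setIntegral_mono_on iX (((iU.fun_sub iV).fun_sub iC).fun_add iE)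
    measurableSet_Ioc hpt
  rw [integral_add ((iU.fun_sub iV).fun_sub iC) iE, integral_sub (iU.fun_sub iV) iC,
    integral_sub iU iV, integral_div, integral_const_mul, integral_const_mul,
    integral_coshProfile_mul_add_eq_zero hR0 hH h0 h1] at hint
  have hle := hmin.trans_le (lam_le_energy (fun τ hτ => le_trans (by norm_num) (hw τ hτ))
    (adm_sinhProfile (by linarith : 0 < m)))
  simp only [energy, Complex.norm_real, Real.norm_eq_abs, sq_abs] at hle
  have hexp := mul_le_mul_of_nonneg_left (integral_exp_neg_Ioc_le_one hR0.le)
    (by positivity : 0 ≤ 68 * M ^ 2)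
  linarith

/-- The weighted `L²` norm of the minimizer:
`|∫₀^{√m} |u_{m,κ,K}|² a_{m,κ,K} dτ − 1/2| ≤ C m⁻¹`, uniformly in `(κ, K)`. -/
theorem minimizer_L2_norm (A B m₁ : ℝ) (hA : 0 < A) (hB : 0 < B) (hm₁ : 1 ≤ m₁)
    (hwt : ∀ m, m₁ ≤ m → ∀ κ K τ : ℝ, |κ| ≤ A → |K| ≤ B →
      τ ∈ Icc 0 (Real.sqrt m) → 1 / 2 ≤ wt m κ K τ) :
    ∃ C : ℝ, 0 < C ∧ ∀ m κ K : ℝ, m₁ ≤ m → |κ| ≤ A → |K| ≤ B →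
      ∀ u g : ℝ → ℂ, Adm m u g → energy m κ K u g = lam m κ K →
        |(∫ τ in Ioc (0 : ℝ) (Real.sqrt m), ‖u τ‖ ^ 2 * wt m κ K τ) - 1 / 2|
          ≤ C / m := by
  obtain ⟨M, hM⟩ : ∃ M, M = 2 * A + 8 * B := ⟨_, rfl⟩
  have hM0 : 0 < M := by rw [hM]; positivity
  refine ⟨272 * M ^ 2 + 2 * M + 19, by positivity, ?_⟩
  intro m κ K hm hκ hK u g hu hmin
  have hm1 : 1 ≤ m := hm₁.trans hm
  have hm0 : 0 < m := by linarith
  have hw : ∀ τ ∈ Ioc 0 √m, 1 / 2 ≤ wt m κ K τ := fun τ hτ =>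
    hwt m hm κ K τ hκ hK (Ioc_subset_Icc_self hτ)
  have hX := integral_norm_sub_sinhProfile_sq_le hm1 hκ hK hw hu hmin
  have hR : 1 ≤ √m := Real.one_le_sqrt.2 hm1
  have hV := abs_integral_sinhProfile_sq_sub_half_le hR
  rw [Real.sq_sqrt hm0.le] at hV
  rw [← hM] at hX
  have hwc := continuous_wt m κ K
  have hvc := continuous_sinhProfile √m
  have huc := hu.1.continuousOn
  have iX : IntegrableOn (fun τ => 2 * m * (‖u τ - sinhProfile √m τ‖ ^ 2 * wt m κ K τ))
      (Ioc 0 √m) :=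
    integrableOn_of_continuousOn (by
      have : ContinuousOn (fun τ => (sinhProfile √m τ : ℂ)) (Icc 0 √m) :=
        (Complex.continuous_ofReal.comp hvc).continuousOn
      exact continuousOn_const.mul (((huc.sub this).norm.pow 2).mul hwc.continuousOn))
  have iU : IntegrableOn (fun τ => ‖u τ‖ ^ 2 * wt m κ K τ) (Ioc 0 √m) :=
    integrableOn_of_continuousOn ((huc.norm.pow 2).mul hwc.continuousOn)
  have iV : IntegrableOn (fun τ => sinhProfile √m τ ^ 2) (Ioc 0 √m) :=
    integrableOn_of_continuousOn (by fun_prop)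
  have iE : IntegrableOn (fun τ => (1 + 2 * M) / m * Real.exp (-τ)) (Ioc 0 √m) :=
    integrableOn_of_continuousOn (by fun_prop)
  have hpt : ∀ τ ∈ Ioc 0 √m, |‖u τ‖ ^ 2 * wt m κ K τ - sinhProfile √m τ ^ 2|
      ≤ 2 * m * (‖u τ - sinhProfile √m τ‖ ^ 2 * wt m κ K τ)
        + (1 + 2 * M) / m * Real.exp (-τ) := by
    intro τ hτ
    have hwτ := hw τ hτ
    refine (abs_sq_mul_sub_sq_le (u τ) (v := sinhProfile √m τ) (by linarith) hm1).trans ?_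
    have b2 : sinhProfile √m τ ^ 2 ≤ Real.exp (-τ) ^ 2 :=
      pow_le_pow_left₀ (sinhProfile_nonneg hR hτ.2) (sinhProfile_le_exp hR hτ.1.le) 2
    have b3 : Real.exp (-τ) ^ 2 ≤ Real.exp (-τ) := by
      rw [← Real.exp_nat_mul]
      exact Real.exp_le_exp.2 (by push_cast; linarith [hτ.1])
    have b4 : Real.exp (-τ) ^ 2 * Real.exp (τ / 2) ≤ Real.exp (-τ) := by
      rw [← Real.exp_nat_mul, ← Real.exp_add]
      exact Real.exp_le_exp.2 (by push_cast; linarith [hτ.1])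
    have hb := abs_wt_sub_one_le hm1 hκ hK hτ.1.le
    rw [← hM] at hb
    have b5 : sinhProfile √m τ ^ 2 * |wt m κ K τ - 1| ≤ M / m * Real.exp (-τ) := by
      calc sinhProfile √m τ ^ 2 * |wt m κ K τ - 1|
          ≤ Real.exp (-τ) ^ 2 * (M / m * Real.exp (τ / 2)) := by gcongr
        _ = M / m * (Real.exp (-τ) ^ 2 * Real.exp (τ / 2)) := by ring
        _ ≤ _ := by gcongr
    have b6 : sinhProfile √m τ ^ 2 * wt m κ K τ ≤ (1 + M) * Real.exp (-τ) := by
      have c1 : sinhProfile √m τ ^ 2 * (wt m κ K τ - 1)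
          ≤ sinhProfile √m τ ^ 2 * |wt m κ K τ - 1| := by gcongr; exact le_abs_self _
      have c2 : M / m * Real.exp (-τ) ≤ M * Real.exp (-τ) := by
        gcongr
        exact div_le_self hM0.le hm1
      linarith
    have b7 : sinhProfile √m τ ^ 2 * wt m κ K τ / m ≤ (1 + M) * Real.exp (-τ) / m := by
      gcongr
    have b8 : (1 + 2 * M) / m * Real.exp (-τ)
        = (1 + M) * Real.exp (-τ) / m + M / m * Real.exp (-τ) := by ring
    linarith
  have hint := setIntegral_mono_on (iU.sub iV).abs (iX.add iE) measurableSet_Ioc hpt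
  simp only [Pi.add_apply] at hint
  rw [integral_add iX iE, integral_const_mul, integral_const_mul] at hint
  have hdiff := abs_integral_le_integral_abs (μ := volume.restrict (Ioc 0 √m))
    (f := fun τ => ‖u τ‖ ^ 2 * wt m κ K τ - sinhProfile √m τ ^ 2)
  rw [integral_sub iU iV] at hdiff
  have hexp := mul_le_mul_of_nonneg_left (integral_exp_neg_Ioc_le_one (Real.sqrt_nonneg m))
    (by positivity : 0 ≤ (1 + 2 * M) / m)
  have hX' := mul_le_mul_of_nonneg_left hX (by positivity : 0 ≤ 2 * m)
  have hC : (272 * M ^ 2 + 2 * M + 19) / m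
      = 2 * m * (136 * (M / m) ^ 2) + (1 + 2 * M) / m * 1 + 18 / m := by
    field_simp
    ring
  rw [hC]
  refine (abs_sub_le _ (∫ τ in Ioc 0 √m, sinhProfile √m τ ^ 2) _).trans (add_le_add ?_ hV)
  exact (hdiff.trans hint).trans (add_le_add hX' hexp)
end
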